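/- Almost-monotonicity of the local L² gradient energy (flat-background case of estimate (4.3) in Theorem 4.2 of the paper): There exists ε₀(n) > 0 such that for every σ ∈ (0,1/4) and all 0 < r < ℓ there is a constant c(n,r,ℓ,σ) > 0 with the following property, where v(σ) := σ/(2+σ). For every y₀ ∈ ℝⁿ, every T ∈ (0,1], and every Ricci–DeTurck flow g on B(y₀,4ℓ) over [0,T] satisfying |g(t,x) − δ| ≤ ε₀(n) for all (t,x), one has for all t ∈ [0,T]: ∫_{B(y₀,r)} |∂g(t)|² dx ≤ ∫_{B(y₀,ℓ)} |∂g(0)|² dx + t^{v(σ)} · c(n,r,ℓ,σ) · (1 + ∫_{B(y₀,ℓ)} |∂g(0)|^{2+2σ} dx). -/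

import Mathlib

open MeasureTheory Metric Set Filter Topology

noncomputable section

/-- Euclidean space `ℝⁿ`. -/
abbrev Eucl (n : ℕ) : Type := EuclideanSpace ℝ (Fin n)

/-- The partial derivative `∂_a f` of a scalar function in the `a`-th coordinate direction. -/
noncomputable def pd {n : ℕ} (a : Fin n) (f : Eucl n → ℝ) (x : Eucl n) : ℝ :=
  fderiv ℝ f x (EuclideanSpace.single a 1)

/-- Squared Frobenius distance between two `n × n` matrices. -/
def matDistSq {n : ℕ} (A B : Matrix (Fin n) (Fin n) ℝ) : ℝ :=
  ∑ i, ∑ j, (A i j - B i j) ^ 2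

/-- `|∂g|²` for a time-dependent matrix field (flat background). -/
noncomputable def gradSq {n : ℕ} (g : ℝ → Eucl n → Matrix (Fin n) (Fin n) ℝ)
    (t : ℝ) (x : Eucl n) : ℝ :=
  ∑ a, ∑ i, ∑ j, (pd a (fun y => g t y i j) x) ^ 2

/-- `|∂²g|²` for a time-dependent matrix field (flat background). -/
noncomputable def hessSq {n : ℕ} (g : ℝ → Eucl n → Matrix (Fin n) (Fin n) ℝ)
    (t : ℝ) (x : Eucl n) : ℝ :=
  ∑ a, ∑ b, ∑ i, ∑ j, (pd a (fun y => pd b (fun z => g t z i j) y) x) ^ 2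

/-- `|∂k|²` for a static matrix field. -/
noncomputable def gradSqS {n : ℕ} (k : Eucl n → Matrix (Fin n) (Fin n) ℝ) (x : Eucl n) : ℝ :=
  ∑ a, ∑ i, ∑ j, (pd a (fun y => k y i j) x) ^ 2

/-- `|∂²k|²` for a static matrix field. -/
noncomputable def hessSqS {n : ℕ} (k : Eucl n → Matrix (Fin n) (Fin n) ℝ) (x : Eucl n) : ℝ :=
  ∑ a, ∑ b, ∑ i, ∑ j, (pd a (fun y => pd b (fun z => k z i j) y) x) ^ 2

/-- A Ricci–DeTurck flow with flat Euclidean background metric on the spatial set `U`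
over the time set `I`: a jointly smooth family of symmetric positive-definite matrix
fields satisfying the flat-background Ricci–DeTurck equation. -/
def IsRicciDeTurckFlow {n : ℕ} (g : ℝ → Eucl n → Matrix (Fin n) (Fin n) ℝ)
    (I : Set ℝ) (U : Set (Eucl n)) : Prop :=
  (∀ i j : Fin n, ContDiffOn ℝ (⊤ : ℕ∞) (fun p : ℝ × Eucl n => g p.1 p.2 i j) (I ×ˢ U)) ∧
  (∀ t ∈ I, ∀ x ∈ U, (g t x).IsSymm ∧ (g t x).PosDef) ∧
  (∀ t ∈ I, ∀ x ∈ U, ∀ i j : Fin n,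
    deriv (fun s => g s x i j) t =
      (∑ a, ∑ b, (g t x)⁻¹ a b * pd a (fun y => pd b (fun z => g t z i j) y) x)
      + (1/2) * ∑ a, ∑ b, ∑ p, ∑ q, (g t x)⁻¹ a b * (g t x)⁻¹ p q *
        ( pd i (fun y => g t y p a) x * pd j (fun y => g t y q b) x
          + 2 * pd a (fun y => g t y j p) x * pd q (fun y => g t y i b) x
          - 2 * pd a (fun y => g t y j p) x * pd b (fun y => g t y i q) x
          - 2 * pd j (fun y => g t y p a) x * pd b (fun y => g t y i q) x
          - 2 * pd i (fun y => g t y p a) x * pd b (fun y => g t y j q) x ))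

open scoped ContDiff

section Calculus

variable {n : ℕ}

/-- `f` is differentiable at `x` with `∂_a f (x) = f'`. -/
def HasPd (a : Fin n) (f : Eucl n → ℝ) (f' : ℝ) (x : Eucl n) : Prop :=
  DifferentiableAt ℝ f x ∧ pd a f x = f'

namespace HasPd

variable {a : Fin n} {f g : Eucl n → ℝ} {f' g' : ℝ} {x : Eucl n}

theorem of_differentiableAt (h : DifferentiableAt ℝ f x) : HasPd a f (pd a f x) x := ⟨h, rfl⟩

theorem congr_deriv (h : HasPd a f f' x) (e : f' = g') : HasPd a f g' x := e ▸ h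

theorem add (hf : HasPd a f f' x) (hg : HasPd a g g' x) :
    HasPd a (fun y => f y + g y) (f' + g') x := by
  refine ⟨hf.1.add hg.1, ?_⟩
  rw [← hf.2, ← hg.2, pd, fderiv_fun_add hf.1 hg.1]; rfl

theorem sub (hf : HasPd a f f' x) (hg : HasPd a g g' x) :
    HasPd a (fun y => f y - g y) (f' - g') x := by
  refine ⟨hf.1.sub hg.1, ?_⟩
  rw [← hf.2, ← hg.2, pd, fderiv_fun_sub hf.1 hg.1]; rfl

theorem mul (hf : HasPd a f f' x) (hg : HasPd a g g' x) :
    HasPd a (fun y => f y * g y) (f' * g x + f x * g') x := by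
  refine ⟨hf.1.mul hg.1, ?_⟩
  rw [← hf.2, ← hg.2, pd, fderiv_fun_mul hf.1 hg.1]
  simp [pd]; ring

theorem const (c : ℝ) : HasPd a (fun _ => c) 0 x :=
  ⟨differentiableAt_const c, by simp [pd]⟩

theorem const_mul (c : ℝ) (hf : HasPd a f f' x) : HasPd a (fun y => c * f y) (c * f') x :=
  ((const c).mul hf).congr_deriv (by ring)

theorem pow (hf : HasPd a f f' x) (m : ℕ) :
    HasPd a (fun y => f y ^ m) (m * f x ^ (m - 1) * f') x := by
  refine ⟨hf.1.pow m, ?_⟩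
  rw [← hf.2, pd, fderiv_fun_pow m hf.1]
  simp [pd]

theorem sum {ι : Type*} (s : Finset ι) {F : ι → Eucl n → ℝ} {F' : ι → ℝ}
    (h : ∀ i ∈ s, HasPd a (F i) (F' i) x) :
    HasPd a (fun y => ∑ i ∈ s, F i y) (∑ i ∈ s, F' i) x := by
  refine ⟨DifferentiableAt.fun_sum fun i hi => (h i hi).1, ?_⟩
  rw [pd, fderiv_fun_sum fun i hi => (h i hi).1, _root_.sum_apply]
  exact Finset.sum_congr rfl fun i hi => (h i hi).2

end HasPd

theorem fderiv_apply_comm {X : Type*} [NormedAddCommGroup X] [NormedSpace ℝ X] {f : X → ℝ}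
    {x : X} (hf : ContDiffAt ℝ ∞ f x) (v w : X) :
    fderiv ℝ (fun y => fderiv ℝ f y v) x w = fderiv ℝ (fun y => fderiv ℝ f y w) x v := by
  have hd : DifferentiableAt ℝ (fderiv ℝ f) x :=
    (hf.fderiv_right (m := 1) (by norm_cast)).differentiableAt (by simp)
  have key : ∀ u z : X, fderiv ℝ (fun y => fderiv ℝ f y u) x z = fderiv ℝ (fderiv ℝ f) x z u := by
    intro u z
    rw [fderiv_clm_apply hd (differentiableAt_const u)]
    simp
  rw [key, key]
  exact (hf.isSymmSndFDerivAt (by simp; norm_cast)) w v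

theorem ContDiffOn.pd {U : Set (Eucl n)} (hU : IsOpen U) {f : Eucl n → ℝ}
    (hf : ContDiffOn ℝ ∞ f U) (a : Fin n) : ContDiffOn ℝ ∞ (pd a f) U :=
  (hf.fderiv_of_isOpen hU (m := ∞) (by norm_cast)).clm_apply contDiffOn_const

theorem pd_comm {f : Eucl n → ℝ} {x : Eucl n} (hf : ContDiffAt ℝ ∞ f x) (a b : Fin n) :
    pd a (pd b f) x = pd b (pd a f) x :=
  fderiv_apply_comm hf _ _

theorem pd_congr {U : Set (Eucl n)} (hU : IsOpen U) {f g : Eucl n → ℝ} (h : EqOn f g U)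
    {x : Eucl n} (hx : x ∈ U) (a : Fin n) : pd a f x = pd a g x := by
  rw [pd, pd, (h.eventuallyEq_of_mem (hU.mem_nhds hx)).fderiv_eq]

/-- The Schwarz rule in the form `∂_a ∂_a ∂_b = ∂_b ∂_a ∂_a`. -/
theorem pd_pd_pd_comm {U : Set (Eucl n)} (hU : IsOpen U) {f : Eucl n → ℝ}
    (hf : ContDiffOn ℝ ∞ f U) {x : Eucl n} (hx : x ∈ U) (a b : Fin n) :
    pd a (pd a (pd b f)) x = pd b (pd a (pd a f)) x := by
  rw [pd_congr hU (fun y hy => pd_comm (hf.contDiffAt (hU.mem_nhds hy)) a b) hx a]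
  exact pd_comm ((hf.pd hU a).contDiffAt (hU.mem_nhds hx)) a b

end Calculus

section Integration

variable {n : ℕ}

theorem integrable_mul_of_tsupport_subset {U : Set (Eucl n)} {η w : Eucl n → ℝ}
    (hη : Continuous η) (hc : HasCompactSupport η) (hs : tsupport η ⊆ U) (hw : ContinuousOn w U) :
    Integrable (fun x => η x * w x) := by
  have h : IntegrableOn (fun x => η x * w x) (tsupport η) :=
    (hη.continuousOn.mul (hw.mono hs)).integrableOn_compact hc
  refine (integrableOn_iff_integrable_of_support_subset fun x hx => ?_).1 h
  exact subset_tsupport η (left_ne_zero_of_mul hx)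

theorem integral_pd_mul_eq_zero {U : Set (Eucl n)} (hU : IsOpen U) {η w : Eucl n → ℝ}
    (hη : ContDiff ℝ ∞ η) (hc : HasCompactSupport η) (hs : tsupport η ⊆ U)
    (hw : ContDiffOn ℝ ∞ w U) (a : Fin n) :
    Integrable (fun x => pd a η x * w x + η x * pd a w x) ∧
      ∫ x, (pd a η x * w x + η x * pd a w x) = 0 := by
  have hpc : Continuous (pd a η) := (hη.continuous_fderiv (by simp)).clm_apply continuous_const
  have hts : tsupport (pd a η) ⊆ tsupport η :=
    (tsupport_fderiv_apply_subset ℝ _)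
  have h1 : Integrable (fun x => pd a η x * w x) :=
    integrable_mul_of_tsupport_subset hpc (hc.mono' (subset_closure.trans hts))
      (hts.trans hs) hw.continuousOn
  have h2 : Integrable (fun x => η x * pd a w x) :=
    integrable_mul_of_tsupport_subset hη.continuous hc hs (hw.pd hU a).continuousOn
  refine ⟨h1.add h2, ?_⟩
  rw [integral_add h1 h2, add_comm]
  have := integral_mul_fderiv_eq_neg_fderiv_mul_of_integrable (μ := volume) (f := η) (g := w)
    (v := EuclideanSpace.single a 1) h1 h2
    (integrable_mul_of_tsupport_subset hη.continuous hc hs hw.continuousOn)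
    (fun x _ => hη.differentiable (by simp) x)
    (fun x hx => (hw.contDiffAt (hU.mem_nhds (hs hx))).differentiableAt (by simp))
  simp only [pd]
  linarith

theorem hasDerivAt_integral_mul {U : Set (Eucl n)} {T : ℝ} {η : Eucl n → ℝ}
    (hη : Continuous η) (hc : HasCompactSupport η) (hs : tsupport η ⊆ U)
    {h h' : ℝ → Eucl n → ℝ}
    (hcont : ContinuousOn (fun p : ℝ × Eucl n => h p.1 p.2) (Ioo 0 T ×ˢ U))
    (hcont' : ContinuousOn (fun p : ℝ × Eucl n => h' p.1 p.2) (Ioo 0 T ×ˢ U))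
    (hd : ∀ t ∈ Ioo 0 T, ∀ x ∈ U, HasDerivAt (fun s => h s x) (h' t x) t)
    {t : ℝ} (ht : t ∈ Ioo 0 T) :
    HasDerivAt (fun s => ∫ x, η x * h s x) (∫ x, η x * h' t x) t := by
  obtain ⟨δ, hδ, hsub⟩ := Metric.isOpen_iff.1 isOpen_Ioo t ht
  have hsub' : closedBall t (δ / 2) ⊆ Ioo 0 T :=
    (closedBall_subset_ball (by linarith)).trans hsub
  obtain ⟨C, hC⟩ := ((isCompact_closedBall t (δ / 2)).prod hc).exists_bound_of_continuousOn
    (hcont'.mono (prod_mono hsub' hs))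
  have slice : ∀ {k : ℝ → Eucl n → ℝ},
      ContinuousOn (fun p : ℝ × Eucl n => k p.1 p.2) (Ioo 0 T ×ˢ U) → ∀ s ∈ Ioo 0 T,
      ContinuousOn (k s) U := fun hk s hs =>
    hk.comp (f := fun x => (s, x)) (by fun_prop) fun x hx => ⟨hs, hx⟩
  have int : ∀ {k : ℝ → Eucl n → ℝ},
      ContinuousOn (fun p : ℝ × Eucl n => k p.1 p.2) (Ioo 0 T ×ˢ U) → ∀ s ∈ Ioo 0 T,
      Integrable (fun x => η x * k s x) := fun hk s hs' =>
    integrable_mul_of_tsupport_subset hη hc hs (slice hk s hs')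
  refine (hasDerivAt_integral_of_dominated_loc_of_deriv_le (bound := fun x => |η x| * C)
    (F := fun s x => η x * h s x) (F' := fun s x => η x * h' s x)
    (closedBall_mem_nhds t (half_pos hδ)) ?_ (int hcont t ht)
    (int hcont' t ht).aestronglyMeasurable ?_ ?_ ?_).2
  · filter_upwards [isOpen_Ioo.mem_nhds ht] with s hs'
    exact (int hcont s hs').aestronglyMeasurable
  · refine ae_of_all _ fun x s hs' => ?_
    rw [norm_mul, Real.norm_eq_abs]
    by_cases hx : x ∈ tsupport η
    · exact mul_le_mul_of_nonneg_left (hC (s, x) ⟨hs', hx⟩) (abs_nonneg _)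
    · simp [image_eq_zero_of_notMem_tsupport hx]
  · exact ((hη.integrable_of_hasCompactSupport hc).abs).mul_const C
  · refine ae_of_all _ fun x s hs' => ?_
    by_cases hx : x ∈ tsupport η
    · exact (hd s (hsub' hs') x (hs hx)).const_mul _
    · simpa [image_eq_zero_of_notMem_tsupport hx] using hasDerivAt_const s (0 : ℝ)

theorem continuousOn_integral_mul {U : Set (Eucl n)} {I : Set ℝ} {η : Eucl n → ℝ}
    (hU : IsOpen U) (hη : Continuous η) (hc : HasCompactSupport η) (hs : tsupport η ⊆ U)
    {h : ℝ → Eucl n → ℝ}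
    (hcont : ContinuousOn (fun p : ℝ × Eucl n => h p.1 p.2) (I ×ˢ U)) :
    ContinuousOn (fun s => ∫ x, η x * h s x) I := by
  refine continuousOn_integral_of_compact_support hc ?_
    fun s x _ hx => by simp [image_eq_zero_of_notMem_tsupport hx]
  rintro ⟨s, x⟩ ⟨hs', -⟩
  by_cases hx : x ∈ U
  · have h1 : ContinuousWithinAt (fun p : ℝ × Eucl n => η p.2 * h p.1 p.2) (I ×ˢ U) (s, x) :=
      ((hη.comp continuous_snd).continuousOn.mul hcont) (s, x) ⟨hs', hx⟩
    refine h1.mono_of_mem_nhdsWithin ?_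
    rw [nhdsWithin_prod_eq, nhdsWithin_univ]
    exact prod_mem_prod self_mem_nhdsWithin (hU.mem_nhds hx)
  · have hx' : (tsupport η)ᶜ ∈ 𝓝 x :=
      (isClosed_tsupport η).isOpen_compl.mem_nhds fun h' => hx (hs h')
    have h0 : ContinuousAt (fun _ : ℝ × Eucl n => (0 : ℝ)) (s, x) := continuousAt_const
    refine (h0.congr ?_).continuousWithinAt
    filter_upwards [continuous_snd.continuousAt.preimage_mem_nhds hx'] with p hp
    simp [Function.uncurry, image_eq_zero_of_notMem_tsupport hp]

end Integration

section Pointwise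

variable {n : ℕ}

theorem abs_sum_le_card_mul {f : Fin n → ℝ} {B : ℝ} (h : ∀ i, |f i| ≤ B) :
    |∑ i, f i| ≤ n * B := by
  calc |∑ i, f i| ≤ ∑ i, |f i| := Finset.abs_sum_le_sum_abs _ _
    _ ≤ ∑ _i : Fin n, B := Finset.sum_le_sum fun i _ => h i
    _ = n * B := by simp

theorem abs_sum_sum_le {f : Fin n → Fin n → ℝ} {B : ℝ} (h : ∀ i j, |f i j| ≤ B) :
    |∑ i, ∑ j, f i j| ≤ (n : ℝ) ^ 2 * B :=
  (abs_sum_le_card_mul fun i => abs_sum_le_card_mul (h i)).trans_eq (by ring)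

theorem abs_sum_sum_sum_le {f : Fin n → Fin n → Fin n → ℝ} {B : ℝ}
    (h : ∀ i j k, |f i j k| ≤ B) : |∑ i, ∑ j, ∑ k, f i j k| ≤ (n : ℝ) ^ 3 * B :=
  (abs_sum_le_card_mul fun i => abs_sum_sum_le (h i)).trans_eq (by ring)

theorem sum_rotate (f : Fin n → Fin n → Fin n → ℝ) :
    ∑ i, ∑ j, ∑ b, f i j b = ∑ b, ∑ i, ∑ j, f i j b := by
  rw [Finset.sum_congr rfl fun i _ => Finset.sum_comm, Finset.sum_comm]

theorem abs_mul_le_mul {a b A B : ℝ} (ha : |a| ≤ A) (hb : |b| ≤ B) : |a * b| ≤ A * B := by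
  rw [abs_mul]
  exact mul_le_mul ha hb (abs_nonneg _) ((abs_nonneg _).trans ha)

theorem absorb_errors {k L ε x y : ℝ} (hk : 1 ≤ k) (hε : ε * (1000 * k ^ 2) ≤ 1) :
    -2 * y ^ 2 - 1000 * k ^ 2 * x ^ 4 +
      k * (4 * ε * y ^ 2 + 39 * (x ^ 2 * y) + 40 * L * (x * y) + 148 * L * x ^ 3)
      ≤ 10 ^ 7 * (L * k) ^ 4 := by
  have h1 : k * (4 * ε * y ^ 2) ≤ y ^ 2 / 4 := by
    have : k * ε ≤ 1 / 1000 := by nlinarith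
    nlinarith [sq_nonneg y]
  have h2 : k * (39 * (x ^ 2 * y)) ≤ y ^ 2 / 2 + 761 * k ^ 2 * x ^ 4 := by
    nlinarith [sq_nonneg (y - 39 * k * x ^ 2), mul_nonneg (sq_nonneg k) (sq_nonneg (x ^ 2))]
  have h3 : k * (40 * L * (x * y)) ≤ y ^ 2 + 400 * (L * k) ^ 2 * x ^ 2 := by
    nlinarith [sq_nonneg (y - 20 * (L * k) * x)]
  have h4 : 400 * (L * k) ^ 2 * x ^ 2 ≤ x ^ 4 + 40000 * (L * k) ^ 4 := by
    nlinarith [sq_nonneg (x ^ 2 - 200 * (L * k) ^ 2)]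
  have h5 : k * (148 * L * x ^ 3) ≤ x ^ 4 + 5476 * (L * k) ^ 2 * x ^ 2 := by
    nlinarith [sq_nonneg (x ^ 2 - 74 * (L * k) * x)]
  have h6 : 5476 * (L * k) ^ 2 * x ^ 2 ≤ x ^ 4 + 7496644 * (L * k) ^ 4 := by
    nlinarith [sq_nonneg (x ^ 2 - 2738 * (L * k) ^ 2)]
  have h7 : x ^ 4 ≤ k ^ 2 * x ^ 4 := le_mul_of_one_le_left (by positivity) (by nlinarith)
  have h8 : 0 ≤ (L * k) ^ 4 := by positivity
  nlinarith

/-- The integrand obtained from `∂_t (φ⁴ |∂g|²)` by adding divergences. Here `d`, `s`, `th` are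
the first, second and third derivatives of the metric, `h` its distance from the background,
`q` and `m` its time derivative and the gradient of the latter, `e` the gradient of `φ`. -/
theorem energy_integrand_le (hn : 1 ≤ n) {P M L ε φ G H u : ℝ}
    {d m : Fin n → Fin n → Fin n → ℝ} {s th : Fin n → Fin n → Fin n → Fin n → ℝ}
    {q h : Fin n → Fin n → ℝ} {e : Fin n → ℝ}
    (hP : P = (n : ℝ) ^ 4) (hM : M = 1000 * (P ^ 3) ^ 2) (hε0 : 0 ≤ ε) (hε : ε * M ≤ 1)
    (hL : 0 ≤ L) (hφ0 : 0 ≤ φ) (he : ∀ a, |e a| ≤ L)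
    (hG0 : 0 ≤ G) (hH0 : 0 ≤ H) (hu : u = ∑ a, ∑ i, ∑ j, d a i j ^ 2) (hG : G ^ 2 = u)
    (hH : H ^ 2 = ∑ a, ∑ b, ∑ i, ∑ j, s a b i j ^ 2)
    (hd : ∀ a i j, |d a i j| ≤ G) (hs : ∀ a b i j, |s a b i j| ≤ H)
    (hh : ∀ i j, |h i j| ≤ ε)
    (hR : ∀ i j, |q i j - ∑ a, s a a i j| ≤ P * (2 * ε * H + 18 * G ^ 2)) :
    φ ^ 4 * (2 * ∑ a, ∑ i, ∑ j, d a i j * m a i j) +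
      ∑ a, (4 * φ ^ 3 * e a *
          (-2 * (∑ i, ∑ j, d a i j * q i j + ∑ i, ∑ j, ∑ b, d b i j * s a b i j
            - ∑ i, ∑ j, ∑ b, d a i j * s b b i j) - M * (u * ∑ i, ∑ j, d a i j * h i j)) +
        φ ^ 4 *
          (-2 * (∑ i, ∑ j, (s a a i j * q i j + d a i j * m a i j)
            + ∑ i, ∑ j, ∑ b, (s a b i j * s a b i j + d b i j * th a b i j)
            - ∑ i, ∑ j, ∑ b, (s a a i j * s b b i j + d a i j * th b a i j))
            - M * ((∑ b, ∑ k, ∑ l, 2 * d b k l * s a b k l) * (∑ i, ∑ j, d a i j * h i j)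
              + u * ∑ i, ∑ j, (s a a i j * h i j + d a i j * d a i j))))
      ≤ 10 ^ 7 * (L * P ^ 3) ^ 4 := by
  have hN : (1 : ℝ) ≤ n := by exact_mod_cast hn
  have hN1 : (n : ℝ) ≤ P := hP ▸ le_self_pow₀ hN (by norm_num)
  have hN2 : (n : ℝ) ^ 2 ≤ P := hP ▸ pow_le_pow_right₀ hN (by norm_num)
  have hN3 : (n : ℝ) ^ 3 ≤ P := hP ▸ pow_le_pow_right₀ hN (by norm_num)
  have hP1 : 1 ≤ P := hN.trans hN1
  have hP3 : 1 ≤ P ^ 3 := one_le_pow₀ hP1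
  have hM0 : 0 < M := by rw [hM]; positivity
  have hε1 : ε ≤ 1 := by
    have : 1 ≤ M := by rw [hM]; nlinarith [one_le_pow₀ hP3 (n := 2)]
    nlinarith
  have hu0 : 0 ≤ u := hG ▸ sq_nonneg G
  -- the terms that are not signed
  let E : Fin n → ℝ := fun a =>
    -2 * φ ^ 4 * (∑ i, ∑ j, s a a i j * (q i j - ∑ b, s b b i j))
      - 8 * φ ^ 3 * e a * (∑ i, ∑ j, d a i j * q i j + ∑ i, ∑ j, ∑ b, d b i j * s a b i j
            - ∑ i, ∑ j, ∑ b, d a i j * s b b i j)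
      - 4 * M * φ ^ 3 * e a * (u * ∑ i, ∑ j, d a i j * h i j)
      - M * φ ^ 4 * ((∑ b, ∑ k, ∑ l, 2 * d b k l * s a b k l) * (∑ i, ∑ j, d a i j * h i j)
              + u * ∑ i, ∑ j, s a a i j * h i j)
  let D : Fin n → ℝ := fun a => ∑ i, ∑ j, d a i j * m a i j
  let S : Fin n → ℝ := fun a => ∑ i, ∑ j, ∑ b, s a b i j * s a b i j
  let W : Fin n → ℝ := fun a => ∑ i, ∑ j, d a i j * d a i j
  let T₁ : Fin n → ℝ := fun a => ∑ i, ∑ j, ∑ b, d b i j * th a b i j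
  let T₂ : Fin n → ℝ := fun a => ∑ i, ∑ j, ∑ b, d a i j * th b a i j
  have hS : ∑ a, S a = H ^ 2 := by
    rw [hH]
    refine Finset.sum_congr rfl fun a _ => ?_
    simp only [S, ← sq]
    exact sum_rotate _
  have hW : ∑ a, W a = u := by simp only [W, hu, ← sq]
  have hT : ∑ a, T₁ a = ∑ a, T₂ a := by
    simp only [T₁, T₂]
    rw [Finset.sum_congr rfl fun a _ => sum_rotate fun i j b => d b i j * th a b i j,
      Finset.sum_congr rfl fun a _ => sum_rotate fun i j b => d a i j * th b a i j]
    exact Finset.sum_comm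
  have hE : ∀ a, E a ≤ P ^ 2 * (4 * ε * (φ ^ 2 * H) ^ 2 + 39 * ((φ * G) ^ 2 * (φ ^ 2 * H))
      + 40 * L * ((φ * G) * (φ ^ 2 * H)) + 148 * L * (φ * G) ^ 3) := by
    intro a
    have hq : ∀ i j, |q i j| ≤ P * (3 * H + 18 * G ^ 2) := fun i j => by
      have h1 : |∑ b, s b b i j| ≤ P * H :=
        (abs_sum_le_card_mul fun b => hs b b i j).trans (by gcongr)
      have h2 := abs_add_le (q i j - ∑ b, s b b i j) (∑ b, s b b i j)
      rw [sub_add_cancel] at h2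
      have h3 : P * (ε * H) ≤ P * H := by
        gcongr; exact mul_le_of_le_one_left hH0 hε1
      linarith [hR i j]
    have b1 : |∑ i, ∑ j, s a a i j * (q i j - ∑ b, s b b i j)|
        ≤ P * (H * (P * (2 * ε * H + 18 * G ^ 2))) :=
      (abs_sum_sum_le fun i j => abs_mul_le_mul (hs a a i j) (hR i j)).trans (by gcongr)
    have b2 : |∑ i, ∑ j, d a i j * q i j| ≤ P * (G * (P * (3 * H + 18 * G ^ 2))) :=
      (abs_sum_sum_le fun i j => abs_mul_le_mul (hd a i j) (hq i j)).trans (by gcongr)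
    have b3 : |∑ i, ∑ j, ∑ b, d b i j * s a b i j| ≤ P * (G * H) :=
      (abs_sum_sum_sum_le fun i j b => abs_mul_le_mul (hd b i j) (hs a b i j)).trans (by gcongr)
    have b4 : |∑ i, ∑ j, ∑ b, d a i j * s b b i j| ≤ P * (G * H) :=
      (abs_sum_sum_sum_le fun i j b => abs_mul_le_mul (hd a i j) (hs b b i j)).trans (by gcongr)
    have b5 : |∑ i, ∑ j, d a i j * h i j| ≤ P * (G * ε) :=
      (abs_sum_sum_le fun i j => abs_mul_le_mul (hd a i j) (hh i j)).trans (by gcongr)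
    have b6 : |∑ b, ∑ k, ∑ l, 2 * d b k l * s a b k l| ≤ P * (2 * (G * H)) := by
      refine (abs_sum_sum_sum_le (B := 2 * (G * H)) fun b k l => ?_).trans (by gcongr)
      rw [mul_assoc, abs_mul, abs_two]
      gcongr
      exact abs_mul_le_mul (hd b k l) (hs a b k l)
    have b7 : |∑ i, ∑ j, s a a i j * h i j| ≤ P * (H * ε) :=
      (abs_sum_sum_le fun i j => abs_mul_le_mul (hs a a i j) (hh i j)).trans (by gcongr)
    simp only [E]
    generalize (∑ i, ∑ j, s a a i j * (q i j - ∑ b, s b b i j)) = x1 at b1 ⊢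
    generalize (∑ i, ∑ j, d a i j * q i j) = x2 at b2 ⊢
    generalize (∑ i, ∑ j, ∑ b, d b i j * s a b i j) = x3 at b3 ⊢
    generalize (∑ i, ∑ j, ∑ b, d a i j * s b b i j) = x4 at b4 ⊢
    generalize (∑ i, ∑ j, d a i j * h i j) = x5 at b5 ⊢
    generalize (∑ b, ∑ k, ∑ l, 2 * d b k l * s a b k l) = x6 at b6 ⊢
    generalize (∑ i, ∑ j, s a a i j * h i j) = x7 at b7 ⊢
    have hx : 0 ≤ φ * G := by positivity
    have hy : 0 ≤ φ ^ 2 * H := by positivity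
    have hPP : P ≤ P ^ 2 := le_self_pow₀ hP1 (by norm_num)
    have c1 : -2 * φ ^ 4 * x1 ≤ P ^ 2 * (4 * ε * (φ ^ 2 * H) ^ 2
        + 36 * ((φ * G) ^ 2 * (φ ^ 2 * H))) := by
      have := mul_le_mul_of_nonneg_left ((neg_le_abs x1).trans b1)
        (by positivity : 0 ≤ 2 * φ ^ 4)
      linarith
    have c2 : -(8 * φ ^ 3 * e a * (x2 + x3 - x4)) ≤ P ^ 2 *
        (40 * L * ((φ * G) * (φ ^ 2 * H)) + 144 * L * (φ * G) ^ 3) := by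
      have t : |x2 + x3 - x4| ≤ P ^ 2 * (5 * G * H + 18 * G ^ 3) := by
        have t1 := abs_sub (x2 + x3) x4
        have t2 := abs_add_le x2 x3
        have t3 : P * (G * H) ≤ P ^ 2 * (G * H) := by gcongr
        linarith
      have := mul_le_mul_of_nonneg_left ((neg_le_abs _).trans (abs_mul_le_mul (he a) t))
        (by positivity : 0 ≤ 8 * φ ^ 3)
      linarith
    have hMε : ∀ z : ℝ, 0 ≤ z → P ^ 2 * (M * ε * z) ≤ P ^ 2 * z := fun z hz => by
      gcongr
      exact mul_le_of_le_one_left hz (by linarith)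
    have c3 : -(4 * M * φ ^ 3 * e a * (u * x5)) ≤ P ^ 2 * (4 * L * (φ * G) ^ 3) := by
      have t : |e a * x5| ≤ L * (P ^ 2 * (G * ε)) :=
        abs_mul_le_mul (he a) (b5.trans (by gcongr))
      have := mul_le_mul_of_nonneg_left ((neg_le_abs _).trans t)
        (by positivity : 0 ≤ 4 * M * φ ^ 3 * u)
      have h2 := hMε (4 * L * (φ * G) ^ 3) (by positivity)
      rw [← hG] at this ⊢
      linarith
    have c4 : -(M * φ ^ 4 * (x6 * x5 + u * x7)) ≤
        P ^ 2 * (3 * ((φ * G) ^ 2 * (φ ^ 2 * H))) := by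
      have t1 := abs_mul_le_mul b6 b5
      have t2 : |u * x7| ≤ G ^ 2 * (P ^ 2 * (H * ε)) :=
        abs_mul_le_mul (by rw [abs_of_nonneg hu0, hG]) (b7.trans (by gcongr))
      have t := (neg_le_abs _).trans ((abs_add_le (x6 * x5) (u * x7)).trans (add_le_add t1 t2))
      have := mul_le_mul_of_nonneg_left t (by positivity : 0 ≤ M * φ ^ 4)
      have h2 := hMε (3 * ((φ * G) ^ 2 * (φ ^ 2 * H))) (by positivity)
      linarith
    linarith
  have hterm : ∀ a, (4 * φ ^ 3 * e a *
          (-2 * (∑ i, ∑ j, d a i j * q i j + ∑ i, ∑ j, ∑ b, d b i j * s a b i j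
            - ∑ i, ∑ j, ∑ b, d a i j * s b b i j) - M * (u * ∑ i, ∑ j, d a i j * h i j)) +
        φ ^ 4 *
          (-2 * (∑ i, ∑ j, (s a a i j * q i j + d a i j * m a i j)
            + ∑ i, ∑ j, ∑ b, (s a b i j * s a b i j + d b i j * th a b i j)
            - ∑ i, ∑ j, ∑ b, (s a a i j * s b b i j + d a i j * th b a i j))
            - M * ((∑ b, ∑ k, ∑ l, 2 * d b k l * s a b k l) * (∑ i, ∑ j, d a i j * h i j)
              + u * ∑ i, ∑ j, (s a a i j * h i j + d a i j * d a i j)))) =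
      E a - 2 * φ ^ 4 * D a - 2 * φ ^ 4 * S a - M * φ ^ 4 * u * W a
        - 2 * φ ^ 4 * T₁ a + 2 * φ ^ 4 * T₂ a := by
    intro a
    have : (∑ i, ∑ j, s a a i j * (q i j - ∑ b, s b b i j)) =
        ∑ i, ∑ j, s a a i j * q i j - ∑ i, ∑ j, ∑ b, s a a i j * s b b i j := by
      simp only [mul_sub, Finset.sum_sub_distrib, Finset.mul_sum]
    simp only [E, D, S, W, T₁, T₂, this, Finset.sum_add_distrib]
    ring
  rw [Finset.sum_congr rfl fun a _ => hterm a]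
  simp only [Finset.sum_add_distrib, Finset.sum_sub_distrib, ← Finset.mul_sum, hS, hW, hT]
  have hsumE : ∑ a, E a ≤ P ^ 3 * (4 * ε * (φ ^ 2 * H) ^ 2 + 39 * ((φ * G) ^ 2 * (φ ^ 2 * H))
      + 40 * L * ((φ * G) * (φ ^ 2 * H)) + 148 * L * (φ * G) ^ 3) := by
    refine (Finset.sum_le_sum fun a _ => hE a).trans ?_
    rw [Finset.sum_const, Finset.card_univ, Fintype.card_fin, nsmul_eq_mul, pow_succ' P 2,
      mul_assoc P]
    exact mul_le_mul_of_nonneg_right hN1 (by positivity)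
  have key := absorb_errors (x := φ * G) (y := φ ^ 2 * H) (L := L) hP3
    (hM ▸ hε)
  rw [← hM] at key
  have hD : ∑ a, D a = ∑ a, ∑ i, ∑ j, d a i j * m a i j := rfl
  rw [← hG, ← hD]
  linarith

end Pointwise

section StaticEstimate

variable {n : ℕ}

theorem abs_le_sqrt_sum_sum_sum {f : Fin n → Fin n → Fin n → ℝ} (a i j : Fin n) :
    |f a i j| ≤ Real.sqrt (∑ a, ∑ i, ∑ j, f a i j ^ 2) := by
  refine Real.abs_le_sqrt ?_
  calc f a i j ^ 2 ≤ ∑ j, f a i j ^ 2 :=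
        Finset.single_le_sum (f := fun j => f a i j ^ 2) (fun _ _ => by positivity)
          (Finset.mem_univ j)
    _ ≤ ∑ i, ∑ j, f a i j ^ 2 :=
        Finset.single_le_sum (f := fun i => ∑ j, f a i j ^ 2) (fun _ _ => by positivity)
          (Finset.mem_univ i)
    _ ≤ ∑ a, ∑ i, ∑ j, f a i j ^ 2 :=
        Finset.single_le_sum (f := fun a => ∑ i, ∑ j, f a i j ^ 2) (fun _ _ => by positivity)
          (Finset.mem_univ a)

theorem abs_le_sqrt_sum_sum_sum_sum {f : Fin n → Fin n → Fin n → Fin n → ℝ} (a b i j : Fin n) :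
    |f a b i j| ≤ Real.sqrt (∑ a, ∑ b, ∑ i, ∑ j, f a b i j ^ 2) :=
  (abs_le_sqrt_sum_sum_sum (f := f a) b i j).trans <| Real.sqrt_le_sqrt <|
    Finset.single_le_sum (f := fun a => ∑ b, ∑ i, ∑ j, f a b i j ^ 2) (fun _ _ => by positivity)
      (Finset.mem_univ a)

/-- The vector field whose divergence turns the derivative of the gradient energy into an
integrand that is bounded above. -/
def correctionField (M : ℝ) (δ : Fin n → Fin n → ℝ) (k q : Fin n → Fin n → Eucl n → ℝ)
    (a : Fin n) (x : Eucl n) : ℝ :=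
  -2 * (∑ i, ∑ j, pd a (k i j) x * q i j x + ∑ i, ∑ j, ∑ b, pd b (k i j) x * pd a (pd b (k i j)) x
      - ∑ i, ∑ j, ∑ b, pd a (k i j) x * pd b (pd b (k i j)) x)
    - M * ((∑ b, ∑ i, ∑ j, pd b (k i j) x ^ 2) * ∑ i, ∑ j, pd a (k i j) x * (k i j x - δ i j))

theorem contDiffOn_correctionField {U : Set (Eucl n)} (hU : IsOpen U) {M : ℝ}
    {δ : Fin n → Fin n → ℝ} {k q : Fin n → Fin n → Eucl n → ℝ}
    (hk : ∀ i j, ContDiffOn ℝ ∞ (k i j) U) (hq : ∀ i j, ContDiffOn ℝ ∞ (q i j) U) (a : Fin n) :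
    ContDiffOn ℝ ∞ (correctionField M δ k q a) U := by
  have h1 : ∀ a i j, ContDiffOn ℝ ∞ (pd a (k i j)) U := fun a i j => (hk i j).pd hU a
  have h2 : ∀ a b i j, ContDiffOn ℝ ∞ (pd a (pd b (k i j))) U := fun a b i j => (h1 b i j).pd hU a
  unfold correctionField
  refine ContDiffOn.sub (contDiffOn_const.mul (ContDiffOn.sub (ContDiffOn.add ?_ ?_) ?_))
    (contDiffOn_const.mul (ContDiffOn.mul ?_ ?_))
  · exact ContDiffOn.sum fun i _ => ContDiffOn.sum fun j _ => (h1 a i j).mul (hq i j)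
  · exact ContDiffOn.sum fun i _ => ContDiffOn.sum fun j _ => ContDiffOn.sum fun b _ =>
      (h1 b i j).mul (h2 a b i j)
  · exact ContDiffOn.sum fun i _ => ContDiffOn.sum fun j _ => ContDiffOn.sum fun b _ =>
      (h1 a i j).mul (h2 b b i j)
  · exact ContDiffOn.sum fun b _ => ContDiffOn.sum fun i _ => ContDiffOn.sum fun j _ =>
      (h1 b i j).pow 2
  · exact ContDiffOn.sum fun i _ => ContDiffOn.sum fun j _ =>
      (h1 a i j).mul ((hk i j).sub contDiffOn_const)

theorem pd_correctionField {U : Set (Eucl n)} (hU : IsOpen U) {M : ℝ}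
    {δ : Fin n → Fin n → ℝ} {k q : Fin n → Fin n → Eucl n → ℝ}
    (hk : ∀ i j, ContDiffOn ℝ ∞ (k i j) U) (hq : ∀ i j, ContDiffOn ℝ ∞ (q i j) U)
    {x : Eucl n} (hx : x ∈ U) (a : Fin n) :
    pd a (correctionField M δ k q a) x =
      -2 * (∑ i, ∑ j, (pd a (pd a (k i j)) x * q i j x + pd a (k i j) x * pd a (q i j) x)
        + ∑ i, ∑ j, ∑ b, (pd a (pd b (k i j)) x * pd a (pd b (k i j)) x
          + pd b (k i j) x * pd a (pd a (pd b (k i j))) x)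
        - ∑ i, ∑ j, ∑ b, (pd a (pd a (k i j)) x * pd b (pd b (k i j)) x
          + pd a (k i j) x * pd b (pd b (pd a (k i j))) x))
      - M * ((∑ b, ∑ i, ∑ j, 2 * pd b (k i j) x * pd a (pd b (k i j)) x)
            * (∑ i, ∑ j, pd a (k i j) x * (k i j x - δ i j))
          + (∑ b, ∑ i, ∑ j, pd b (k i j) x ^ 2)
            * ∑ i, ∑ j, (pd a (pd a (k i j)) x * (k i j x - δ i j)
              + pd a (k i j) x * pd a (k i j) x)) := by
  have h1 : ∀ a i j, ContDiffOn ℝ ∞ (pd a (k i j)) U := fun a i j => (hk i j).pd hU a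
  have h2 : ∀ a b i j, ContDiffOn ℝ ∞ (pd a (pd b (k i j))) U := fun a b i j => (h1 b i j).pd hU a
  have D : ∀ {f : Eucl n → ℝ}, ContDiffOn ℝ ∞ f U → HasPd a f (pd a f x) x := fun hf =>
    HasPd.of_differentiableAt ((hf.contDiffAt (hU.mem_nhds hx)).differentiableAt (by simp))
  have hcomm : ∀ b i j, pd a (pd b (pd b (k i j))) x = pd b (pd b (pd a (k i j))) x :=
    fun b i j => (pd_pd_pd_comm hU (hk i j) hx b a).symm
  refine (HasPd.sub (HasPd.const_mul (-2) (HasPd.sub (HasPd.add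
    (HasPd.sum _ fun i _ => HasPd.sum _ fun j _ => (D (h1 a i j)).mul (D (hq i j)))
    (HasPd.sum _ fun i _ => HasPd.sum _ fun j _ => HasPd.sum _ fun b _ =>
      (D (h1 b i j)).mul (D (h2 a b i j))))
    (HasPd.sum _ fun i _ => HasPd.sum _ fun j _ => HasPd.sum _ fun b _ =>
      ((D (h1 a i j)).mul (D (h2 b b i j))).congr_deriv (by rw [hcomm]))))
    (HasPd.const_mul M (HasPd.mul
      (HasPd.sum _ fun b _ => HasPd.sum _ fun i _ => HasPd.sum _ fun j _ =>
        ((D (h1 b i j)).pow 2).congr_deriv (by norm_num))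
      (HasPd.sum _ fun i _ => HasPd.sum _ fun j _ =>
        ((D (h1 a i j)).mul ((D (hk i j)).sub (HasPd.const (δ i j)))).congr_deriv
          (by rw [sub_zero]))))).2

theorem integral_energy_deriv_le (hn : 1 ≤ n) {P M L ε : ℝ} (hP : P = (n : ℝ) ^ 4)
    (hM : M = 1000 * (P ^ 3) ^ 2) (hε0 : 0 ≤ ε) (hε : ε * M ≤ 1) (hL : 0 ≤ L)
    {U V : Set (Eucl n)} (hU : IsOpen U) (hV : MeasurableSet V) (hVfin : volume V ≠ ⊤)
    {φ : Eucl n → ℝ} (hφ : ContDiff ℝ ∞ φ) (hφc : HasCompactSupport φ) (hφU : tsupport φ ⊆ U)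
    (hφV : tsupport φ ⊆ V) (hφ0 : ∀ x, 0 ≤ φ x) (hφL : ∀ a x, |pd a φ x| ≤ L)
    {δ : Fin n → Fin n → ℝ} {k q : Fin n → Fin n → Eucl n → ℝ}
    (hk : ∀ i j, ContDiffOn ℝ ∞ (k i j) U) (hq : ∀ i j, ContDiffOn ℝ ∞ (q i j) U)
    (hh : ∀ x ∈ U, ∀ i j, |k i j x - δ i j| ≤ ε)
    (hR : ∀ x ∈ U, ∀ i j, |q i j x - ∑ a, pd a (pd a (k i j)) x| ≤
      P * (2 * ε * Real.sqrt (∑ a, ∑ b, ∑ i, ∑ j, pd a (pd b (k i j)) x ^ 2)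
        + 18 * ∑ a, ∑ i, ∑ j, pd a (k i j) x ^ 2)) :
    ∫ x, φ x ^ 4 * (2 * ∑ a, ∑ i, ∑ j, pd a (k i j) x * pd a (q i j) x)
      ≤ 10 ^ 7 * (L * P ^ 3) ^ 4 * volume.real V := by
  have hη : ContDiff ℝ ∞ (fun x => φ x ^ 4) := hφ.pow 4
  have hts : tsupport (fun x => φ x ^ 4) ⊆ tsupport φ :=
    closure_mono fun x hx h => hx (by simp [h])
  have hηc : HasCompactSupport (fun x => φ x ^ 4) := hφc.mono' (subset_closure.trans hts)
  have hw := fun a => contDiffOn_correctionField (M := M) (δ := δ) hU hk hq a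
  have ibp := fun a => integral_pd_mul_eq_zero hU hη hηc (hts.trans hφU) (hw a) a
  have hpdη : ∀ a x, pd a (fun x => φ x ^ 4) x = 4 * φ x ^ 3 * pd a φ x := fun a x =>
    ((HasPd.of_differentiableAt (hφ.differentiable (by simp) x)).pow 4).2.trans (by norm_num)
  have hint : Integrable
      (fun x => φ x ^ 4 * (2 * ∑ a, ∑ i, ∑ j, pd a (k i j) x * pd a (q i j) x)) := by
    refine integrable_mul_of_tsupport_subset hη.continuous hηc (hts.trans hφU)
      (continuousOn_const.mul ?_)
    exact continuousOn_finsetSum _ fun a _ => continuousOn_finsetSum _ fun i _ =>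
      continuousOn_finsetSum _ fun j _ =>
        ((hk i j).pd hU a).continuousOn.mul ((hq i j).pd hU a).continuousOn
  have hsum := integrable_finsetSum Finset.univ fun a _ => (ibp a).1
  have hzero : ∫ x, ∑ a, (pd a (fun x => φ x ^ 4) x * correctionField M δ k q a x
      + φ x ^ 4 * pd a (correctionField M δ k q a) x) = 0 := by
    rw [integral_finsetSum _ fun a _ => (ibp a).1]
    exact Finset.sum_eq_zero fun a _ => (ibp a).2
  rw [← add_zero (∫ x, φ x ^ 4 * _), ← hzero, ← integral_add hint hsum]
  have hC : ∫ x, V.indicator (fun _ => 10 ^ 7 * (L * P ^ 3) ^ 4) x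
      = 10 ^ 7 * (L * P ^ 3) ^ 4 * volume.real V := by
    rw [integral_indicator_const _ hV, smul_eq_mul, mul_comm]
  rw [← hC]
  refine integral_mono (hint.add hsum)
    ((integrable_indicator_iff hV).2 (integrableOn_const hVfin)) fun x => ?_
  by_cases hx : x ∈ tsupport φ
  · simp only [indicator_of_mem (hφV hx), hpdη, pd_correctionField hU hk hq (hφU hx)]
    have hu0 : 0 ≤ ∑ a, ∑ i, ∑ j, pd a (k i j) x ^ 2 :=
      Finset.sum_nonneg fun a _ => Finset.sum_nonneg fun i _ => Finset.sum_nonneg fun j _ =>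
        sq_nonneg _
    have hs0 : 0 ≤ ∑ a, ∑ b, ∑ i, ∑ j, pd a (pd b (k i j)) x ^ 2 :=
      Finset.sum_nonneg fun a _ => Finset.sum_nonneg fun b _ => Finset.sum_nonneg fun i _ =>
        Finset.sum_nonneg fun j _ => sq_nonneg _
    have hR' := hR x (hφU hx)
    rw [← Real.sq_sqrt hu0] at hR'
    have key := energy_integrand_le hn (φ := φ x)
      (G := Real.sqrt (∑ a, ∑ i, ∑ j, pd a (k i j) x ^ 2))
      (H := Real.sqrt (∑ a, ∑ b, ∑ i, ∑ j, pd a (pd b (k i j)) x ^ 2))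
      (u := ∑ a, ∑ i, ∑ j, pd a (k i j) x ^ 2) (d := fun a i j => pd a (k i j) x)
      (m := fun a i j => pd a (q i j) x) (s := fun a b i j => pd a (pd b (k i j)) x)
      (th := fun a b i j => pd a (pd a (pd b (k i j))) x) (q := fun i j => q i j x)
      (h := fun i j => k i j x - δ i j) (e := fun a => pd a φ x)
      hP hM hε0 hε hL (hφ0 x) (fun a => hφL a x) (Real.sqrt_nonneg _) (Real.sqrt_nonneg _)
      rfl (Real.sq_sqrt hu0) (Real.sq_sqrt hs0)
      (fun a i j => abs_le_sqrt_sum_sum_sum (f := fun a i j => pd a (k i j) x) a i j)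
      (fun a b i j => abs_le_sqrt_sum_sum_sum_sum
        (f := fun a b i j => pd a (pd b (k i j)) x) a b i j)
      (hh x (hφU hx)) hR'
    exact key
  · have : φ x = 0 := image_eq_zero_of_notMem_tsupport hx
    simp only [hpdη, this]
    simp only [ne_eq, OfNat.ofNat_ne_zero, not_false_eq_true, zero_pow, zero_mul, mul_zero,
      add_zero, Finset.sum_const_zero]
    exact indicator_nonneg (fun _ _ => by positivity) x

end StaticEstimate

section Residual

variable {n : ℕ}

open scoped Matrix.Norms.Frobenius in
theorem abs_inv_sub_one_le {A : Matrix (Fin n) (Fin n) ℝ} (hA : IsUnit A.det) {ε : ℝ}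
    (hε : ε ≤ 1 / 2) (h : Real.sqrt (matDistSq A 1) ≤ ε) (a b : Fin n) :
    |A⁻¹ a b - (1 : Matrix (Fin n) (Fin n) ℝ) a b| ≤ 2 * ε := by
  have hnorm : ‖A - 1‖ ≤ ε := by
    refine le_trans (le_of_eq ?_) h
    rw [Matrix.frobenius_norm_def, Real.sqrt_eq_rpow, matDistSq]
    simp
  have hid : A⁻¹ - 1 = -(A - 1) - (A⁻¹ - 1) * (A - 1) := by
    have := Matrix.nonsing_inv_mul A hA
    rw [sub_mul, mul_sub, this, mul_one, one_mul]
    abel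
  have h1 : ‖A⁻¹ - 1‖ ≤ ε + ‖A⁻¹ - 1‖ * ε := by
    calc ‖A⁻¹ - 1‖ = ‖-(A - 1) - (A⁻¹ - 1) * (A - 1)‖ := by rw [← hid]
      _ ≤ ‖A - 1‖ + ‖A⁻¹ - 1‖ * ‖A - 1‖ := by
        refine (norm_sub_le _ _).trans ?_
        rw [norm_neg]
        gcongr
        exact norm_mul_le _ _
      _ ≤ _ := by gcongr
  have h2 : |(A⁻¹ - 1) a b| ≤ ‖A⁻¹ - 1‖ := by
    rw [Matrix.frobenius_norm_def, ← Real.sqrt_eq_rpow]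
    refine Real.abs_le_sqrt ?_
    simp only [Real.rpow_two, Real.norm_eq_abs, sq_abs]
    calc (A⁻¹ - 1) a b ^ 2 ≤ ∑ j, (A⁻¹ - 1) a j ^ 2 :=
          Finset.single_le_sum (f := fun j => (A⁻¹ - 1) a j ^ 2) (fun _ _ => sq_nonneg _)
            (Finset.mem_univ b)
      _ ≤ ∑ i, ∑ j, (A⁻¹ - 1) i j ^ 2 :=
          Finset.single_le_sum (f := fun i => ∑ j, (A⁻¹ - 1) i j ^ 2)
            (fun _ _ => Finset.sum_nonneg fun _ _ => sq_nonneg _) (Finset.mem_univ a)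
  rw [Matrix.sub_apply] at h2
  nlinarith [norm_nonneg (A⁻¹ - 1)]

theorem abs_sub_le_of_matDistSq {A B : Matrix (Fin n) (Fin n) ℝ} {ε : ℝ}
    (h : Real.sqrt (matDistSq A B) ≤ ε) (i j : Fin n) : |A i j - B i j| ≤ ε := by
  refine le_trans (Real.abs_le_sqrt ?_) h
  calc (A i j - B i j) ^ 2 ≤ ∑ j, (A i j - B i j) ^ 2 :=
        Finset.single_le_sum (f := fun j => (A i j - B i j) ^ 2) (fun _ _ => sq_nonneg _)
          (Finset.mem_univ j)
    _ ≤ matDistSq A B :=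
        Finset.single_le_sum (f := fun i => ∑ j, (A i j - B i j) ^ 2)
          (fun _ _ => Finset.sum_nonneg fun _ _ => sq_nonneg _) (Finset.mem_univ i)

theorem abs_ricciDeTurck_sub_laplacian_le (hn : 1 ≤ n) {A : Matrix (Fin n) (Fin n) ℝ} {ε G H : ℝ}
    (hε0 : 0 ≤ ε) (hε : ε ≤ 1 / 2) (hH0 : 0 ≤ H)
    (hA : ∀ a b, |A a b - (1 : Matrix (Fin n) (Fin n) ℝ) a b| ≤ 2 * ε)
    {d : Fin n → Fin n → Fin n → ℝ} {s : Fin n → Fin n → ℝ}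
    (hd : ∀ a i j, |d a i j| ≤ G) (hs : ∀ a b, |s a b| ≤ H) (i j : Fin n) :
    |((∑ a, ∑ b, A a b * s a b) + (1 / 2) * ∑ a, ∑ b, ∑ p, ∑ q, A a b * A p q *
        (d i p a * d j q b + 2 * d a j p * d q i b - 2 * d a j p * d b i q
          - 2 * d j p a * d b i q - 2 * d i p a * d b j q)) - ∑ a, s a a|
      ≤ (n : ℝ) ^ 4 * (2 * ε * H + 18 * G ^ 2) := by
  have hN : (1 : ℝ) ≤ n := by exact_mod_cast hn
  have hA2 : ∀ a b, |A a b| ≤ 2 := fun a b => by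
    have h1 : |(1 : Matrix (Fin n) (Fin n) ℝ) a b| ≤ 1 := by
      rw [Matrix.one_apply]; split_ifs <;> simp
    have h2 := abs_add_le (A a b - (1 : Matrix (Fin n) (Fin n) ℝ) a b)
      ((1 : Matrix (Fin n) (Fin n) ℝ) a b)
    rw [sub_add_cancel] at h2
    linarith [hA a b]
  have hdd : ∀ a b c a' b' c', |d a b c * d a' b' c'| ≤ G ^ 2 := fun a b c a' b' c' =>
    (abs_mul_le_mul (hd a b c) (hd a' b' c')).trans_eq (sq G).symm
  have hquad : |∑ a, ∑ b, ∑ p, ∑ q, A a b * A p q *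
        (d i p a * d j q b + 2 * d a j p * d q i b - 2 * d a j p * d b i q
          - 2 * d j p a * d b i q - 2 * d i p a * d b j q)| ≤
      (n : ℝ) ^ 2 * ((n : ℝ) ^ 2 * (2 * 2 * (9 * G ^ 2))) := by
    refine abs_sum_sum_le fun a b => abs_sum_sum_le fun p q => ?_
    refine abs_mul_le_mul (abs_mul_le_mul (hA2 a b) (hA2 p q)) ?_
    have k1 := abs_le.1 (hdd i p a j q b)
    have k2 := abs_le.1 (hdd a j p q i b)
    have k3 := abs_le.1 (hdd a j p b i q)
    have k4 := abs_le.1 (hdd j p a b i q)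
    have k5 := abs_le.1 (hdd i p a b j q)
    rw [abs_le]
    constructor <;> linarith [k1.1, k1.2, k2.1, k2.2, k3.1, k3.2, k4.1, k4.2, k5.1, k5.2]
  have hlin : |∑ a, ∑ b, (A a b - (1 : Matrix (Fin n) (Fin n) ℝ) a b) * s a b| ≤
      (n : ℝ) ^ 2 * (2 * ε * H) :=
    abs_sum_sum_le fun a b => abs_mul_le_mul (hA a b) (hs a b)
  have hsplit : ∑ a, ∑ b, (A a b - (1 : Matrix (Fin n) (Fin n) ℝ) a b) * s a b =
      (∑ a, ∑ b, A a b * s a b) - ∑ a, s a a := by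
    simp [sub_mul, Finset.sum_sub_distrib, Matrix.one_apply]
  rw [hsplit] at hlin
  have h24 : (n : ℝ) ^ 2 * (2 * ε * H) ≤ (n : ℝ) ^ 4 * (2 * ε * H) := by
    gcongr
    norm_num
  rw [abs_le] at hlin hquad ⊢
  constructor <;> linarith [hlin.1, hlin.2, hquad.1, hquad.2]

end Residual

section TimeDependence

variable {n : ℕ} {F : ℝ × Eucl n → ℝ} {I : Set ℝ} {U : Set (Eucl n)}

theorem contDiffOn_slice (hF : ContDiffOn ℝ ∞ F (I ×ˢ U)) {t : ℝ} (ht : t ∈ I) :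
    ContDiffOn ℝ ∞ (fun y => F (t, y)) U :=
  hF.comp (contDiffOn_const.prodMk contDiffOn_id) fun _ hx => ⟨ht, hx⟩

theorem contDiffOn_pd_slice (hI : UniqueDiffOn ℝ I) (hU : IsOpen U)
    (hF : ContDiffOn ℝ ∞ F (I ×ˢ U)) (a : Fin n) :
    ContDiffOn ℝ ∞ (fun p : ℝ × Eucl n => pd a (fun y => F (p.1, y)) p.2) (I ×ˢ U) := by
  have h1 : ContDiffOn ℝ ∞ (fun p => fderivWithin ℝ F (I ×ˢ U) p
      ((0 : ℝ), (EuclideanSpace.single a 1 : Eucl n))) (I ×ˢ U) :=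
    (hF.fderivWithin (hI.prod hU.uniqueDiffOn) (m := ∞) (by norm_cast)).clm_apply contDiffOn_const
  refine h1.congr ?_
  rintro ⟨t, x⟩ ⟨ht, hx⟩
  have hd := ((hF.differentiableOn (by simp)) (t, x) ⟨ht, hx⟩).hasFDerivWithinAt
  have hin : HasFDerivWithinAt (fun y : Eucl n => (t, y)) (ContinuousLinearMap.inr ℝ ℝ (Eucl n))
      U x := (hasFDerivAt_prodMk_right t x).hasFDerivWithinAt
  have := (hd.comp x hin fun y hy => ⟨ht, hy⟩).hasFDerivAt (hU.mem_nhds hx)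
  change fderiv ℝ (F ∘ fun y => (t, y)) x _ = _
  rw [this.fderiv]
  simp

theorem pd_slice_eq {t : ℝ} {x : Eucl n} (h : DifferentiableAt ℝ F (t, x)) (a : Fin n) :
    pd a (fun y => F (t, y)) x = fderiv ℝ F (t, x) (0, EuclideanSpace.single a 1) := by
  have := h.hasFDerivAt.comp x (hasFDerivAt_prodMk_right t x)
  change fderiv ℝ (F ∘ fun y => (t, y)) x _ = _
  rw [this.fderiv]
  simp

theorem hasDerivAt_slice {t : ℝ} {x : Eucl n} (h : DifferentiableAt ℝ F (t, x)) :
    HasDerivAt (fun s => F (s, x)) (fderiv ℝ F (t, x) (1, 0)) t := by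
  have := (h.hasFDerivAt.comp t (hasFDerivAt_prodMk_left t x)).hasDerivAt
  exact this.congr_deriv (by simp)

theorem contDiffOn_deriv_slice (hI : IsOpen I) (hU : IsOpen U) (hF : ContDiffOn ℝ ∞ F (I ×ˢ U)) :
    ContDiffOn ℝ ∞ (fun p : ℝ × Eucl n => deriv (fun s => F (s, p.2)) p.1) (I ×ˢ U) := by
  have h1 : ContDiffOn ℝ ∞ (fun p => fderiv ℝ F p ((1 : ℝ), (0 : Eucl n))) (I ×ˢ U) :=
    (hF.fderiv_of_isOpen (hI.prod hU) (m := ∞) (by norm_cast)).clm_apply contDiffOn_const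
  refine h1.congr ?_
  rintro ⟨t, x⟩ hp
  exact (hasDerivAt_slice ((hF.contDiffAt ((hI.prod hU).mem_nhds hp)).differentiableAt
    (by simp))).deriv

theorem hasDerivAt_pd_slice (hI : IsOpen I) (hU : IsOpen U) (hF : ContDiffOn ℝ ∞ F (I ×ˢ U))
    (a : Fin n) {t : ℝ} (ht : t ∈ I) {x : Eucl n} (hx : x ∈ U) :
    HasDerivAt (fun s => pd a (fun y => F (s, y)) x)
      (pd a (fun y => deriv (fun s => F (s, y)) t) x) t := by
  have hO := hI.prod hU
  have hat : ∀ p ∈ I ×ˢ U, ContDiffAt ℝ ∞ F p := fun p hp => hF.contDiffAt (hO.mem_nhds hp)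
  have hdiff : ∀ p ∈ I ×ˢ U, DifferentiableAt ℝ F p := fun p hp =>
    (hat p hp).differentiableAt (by simp)
  have hv : ∀ v : ℝ × Eucl n, DifferentiableAt ℝ (fun p => fderiv ℝ F p v) (t, x) := fun v =>
    ((((hF.fderiv_of_isOpen hO (m := ∞) (by norm_cast)).clm_apply contDiffOn_const).contDiffAt
      (hO.mem_nhds ⟨ht, hx⟩)).differentiableAt (by simp))
  have e1 : pd a (fun y => deriv (fun s => F (s, y)) t) x =
      pd a (fun y => fderiv ℝ F (t, y) (1, 0)) x :=
    pd_congr hU (fun y hy => (hasDerivAt_slice (hdiff (t, y) ⟨ht, hy⟩)).deriv) hx a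
  rw [e1, pd_slice_eq (F := fun p => fderiv ℝ F p (1, 0)) (hv _) a,
    fderiv_apply_comm (hat (t, x) ⟨ht, hx⟩)]
  refine (hasDerivAt_slice (hv (0, EuclideanSpace.single a 1))).congr_of_eventuallyEq ?_
  filter_upwards [hI.mem_nhds ht] with s hs
  exact pd_slice_eq (hdiff (s, x) ⟨hs, hx⟩) a

end TimeDependence

section Cutoff

/-- Cutoff functions between concentric balls, with a gradient bound independent of the centre. -/
theorem exists_cutoff (n : ℕ) {r ℓ : ℝ} (hr : 0 < r) (hrℓ : r < ℓ) :
    ∃ L : ℝ, 0 ≤ L ∧ ∀ y₀ : Eucl n, ∃ φ : Eucl n → ℝ, ContDiff ℝ ∞ φ ∧ HasCompactSupport φ ∧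
      tsupport φ ⊆ ball y₀ ℓ ∧ (∀ x, 0 ≤ φ x) ∧ (∀ x, φ x ≤ 1) ∧ (∀ x ∈ ball y₀ r, φ x = 1) ∧
      ∀ a x, |pd a φ x| ≤ L := by
  let f : ∀ y₀ : Eucl n, ContDiffBump y₀ := fun y₀ => ⟨r, (r + ℓ) / 2, hr, by linarith⟩
  have hf : ∀ y₀, ContDiff ℝ ∞ (f y₀) := fun y₀ => (f y₀).contDiff
  have htr : ∀ y₀, (f y₀ : Eucl n → ℝ) = fun x => f 0 (x - y₀) := fun y₀ => by
    ext x
    simp [f, ContDiffBump.apply]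
  obtain ⟨L, hL⟩ := ((hf 0).continuous_fderiv (by simp)).bounded_above_of_compact_support
    ((f 0).hasCompactSupport.fderiv ℝ)
  refine ⟨L, (norm_nonneg _).trans (hL 0), fun y₀ => ⟨f y₀, hf y₀, (f y₀).hasCompactSupport, ?_,
    fun x => (f y₀).nonneg, fun x => (f y₀).le_one,
    fun x hx => (f y₀).one_of_mem_closedBall (ball_subset_closedBall hx), fun a x => ?_⟩⟩
  · rw [(f y₀).tsupport_eq]
    exact closedBall_subset_ball (by simp only [f]; linarith)
  · rw [pd, htr y₀, fderiv_comp_sub (f := f 0) y₀, ← Real.norm_eq_abs]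
    refine ((fderiv ℝ (f 0) (x - y₀)).le_opNorm _).trans ?_
    simpa using hL (x - y₀)

end Cutoff

section Evolution

variable {n : ℕ} {g : ℝ → Eucl n → Matrix (Fin n) (Fin n) ℝ} {T : ℝ} {U : Set (Eucl n)}

theorem gradSq_nonneg (g : ℝ → Eucl n → Matrix (Fin n) (Fin n) ℝ) (t : ℝ) (x : Eucl n) :
    0 ≤ gradSq g t x :=
  Finset.sum_nonneg fun _ _ => Finset.sum_nonneg fun _ _ => Finset.sum_nonneg fun _ _ =>
    sq_nonneg _

theorem IsRicciDeTurckFlow.continuousOn_gradSq (hU : IsOpen U) (hT : 0 < T)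
    (hg : IsRicciDeTurckFlow g (Icc 0 T) U) :
    ContinuousOn (fun p : ℝ × Eucl n => gradSq g p.1 p.2) (Icc 0 T ×ˢ U) :=
  continuousOn_finsetSum _ fun a _ => continuousOn_finsetSum _ fun i _ =>
    continuousOn_finsetSum _ fun j _ =>
      ((contDiffOn_pd_slice (uniqueDiffOn_Icc hT) hU (hg.1 i j) a).continuousOn).pow 2

/-- The localized gradient energy grows at most linearly in time. -/
theorem IsRicciDeTurckFlow.localized_energy_le (hn : 1 ≤ n) (hT : 0 < T) {P M L ε : ℝ}
    (hP : P = (n : ℝ) ^ 4) (hM : M = 1000 * (P ^ 3) ^ 2) (hε0 : 0 ≤ ε) (hε : ε * M ≤ 1)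
    (hε' : ε ≤ 1 / 2) (hL : 0 ≤ L)
    {V : Set (Eucl n)} (hU : IsOpen U) (hV : MeasurableSet V) (hVfin : volume V ≠ ⊤)
    {φ : Eucl n → ℝ} (hφ : ContDiff ℝ ∞ φ) (hφc : HasCompactSupport φ) (hφU : tsupport φ ⊆ U)
    (hφV : tsupport φ ⊆ V) (hφ0 : ∀ x, 0 ≤ φ x) (hφL : ∀ a x, |pd a φ x| ≤ L)
    (hg : IsRicciDeTurckFlow g (Icc 0 T) U)
    (hclose : ∀ t ∈ Icc (0 : ℝ) T, ∀ x ∈ U, Real.sqrt (matDistSq (g t x) 1) ≤ ε)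
    {t : ℝ} (ht : t ∈ Icc 0 T) :
    ∫ x, φ x ^ 4 * gradSq g t x ≤
      (∫ x, φ x ^ 4 * gradSq g 0 x) + 10 ^ 7 * (L * P ^ 3) ^ 4 * volume.real V * t := by
  have hη : Continuous (fun x => φ x ^ 4) := hφ.continuous.pow 4
  have hts : tsupport (fun x => φ x ^ 4) ⊆ tsupport φ :=
    closure_mono fun x hx h => hx (by simp [h])
  have hηc : HasCompactSupport (fun x => φ x ^ 4) := hφc.mono' (subset_closure.trans hts)
  have hIoo : Ioo 0 T ×ˢ U ⊆ Icc 0 T ×ˢ U := prod_mono Ioo_subset_Icc_self le_rfl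
  have hF : ∀ i j, ContDiffOn ℝ ∞ (fun p : ℝ × Eucl n => g p.1 p.2 i j) (Ioo 0 T ×ˢ U) :=
    fun i j => (hg.1 i j).mono hIoo
  have hcont := hg.continuousOn_gradSq hU hT
  have hd : ∀ t ∈ Ioo 0 T, HasDerivAt (fun s => ∫ x, φ x ^ 4 * gradSq g s x)
      (∫ x, φ x ^ 4 * (2 * ∑ a, ∑ i, ∑ j, pd a (fun y => g t y i j) x *
        pd a (fun y => deriv (fun s => g s y i j) t) x)) t := by
    intro t ht
    refine hasDerivAt_integral_mul (h' := fun t x => 2 * ∑ a, ∑ i, ∑ j,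
      pd a (fun y => g t y i j) x * pd a (fun y => deriv (fun s => g s y i j) t) x)
      hη hηc (hts.trans hφU) (hcont.mono hIoo) ?_ ?_ ht
    · exact continuousOn_const.mul <| continuousOn_finsetSum _ fun a _ =>
        continuousOn_finsetSum _ fun i _ => continuousOn_finsetSum _ fun j _ =>
          (contDiffOn_pd_slice (uniqueDiffOn_Ioo 0 T) hU (hF i j) a).continuousOn.mul
            (contDiffOn_pd_slice (uniqueDiffOn_Ioo 0 T) hU
              (contDiffOn_deriv_slice isOpen_Ioo hU (hF i j)) a).continuousOn
    · intro s hs x hx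
      simp only [Finset.mul_sum]
      refine HasDerivAt.fun_sum fun a _ => HasDerivAt.fun_sum fun i _ =>
        HasDerivAt.fun_sum fun j _ => ?_
      exact ((hasDerivAt_pd_slice isOpen_Ioo hU (hF i j) a hs hx).fun_pow 2).congr_deriv
        (by norm_num; ring)
  have hbound : ∀ t ∈ Ioo 0 T, ∫ x, φ x ^ 4 * (2 * ∑ a, ∑ i, ∑ j, pd a (fun y => g t y i j) x *
        pd a (fun y => deriv (fun s => g s y i j) t) x)
      ≤ 10 ^ 7 * (L * P ^ 3) ^ 4 * volume.real V := by
    intro t ht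
    have ht' := Ioo_subset_Icc_self ht
    refine integral_energy_deriv_le hn hP hM hε0 hε hL hU hV hVfin hφ hφc hφU hφV hφ0 hφL
      (δ := (1 : Matrix (Fin n) (Fin n) ℝ)) (k := fun i j y => g t y i j)
      (q := fun i j y => deriv (fun s => g s y i j) t)
      (fun i j => contDiffOn_slice (hF i j) ht)
      (fun i j => contDiffOn_slice (contDiffOn_deriv_slice isOpen_Ioo hU (hF i j)) ht)
      (fun x hx i j => abs_sub_le_of_matDistSq (hclose t ht' x hx) i j) fun x hx i j => ?_
    have hu0 := gradSq_nonneg g t x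
    have key := abs_ricciDeTurck_sub_laplacian_le hn hε0 hε'
      (G := Real.sqrt (gradSq g t x)) (H := Real.sqrt (hessSq g t x)) (Real.sqrt_nonneg _)
      (abs_inv_sub_one_le (isUnit_iff_ne_zero.2 (hg.2.1 t ht' x hx).2.det_pos.ne') hε'
        (hclose t ht' x hx))
      (d := fun a i j => pd a (fun y => g t y i j) x)
      (s := fun a b => pd a (pd b fun y => g t y i j) x)
      (fun a i j => abs_le_sqrt_sum_sum_sum (f := fun a i j => pd a (fun y => g t y i j) x) a i j)
      (fun a b => abs_le_sqrt_sum_sum_sum_sum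
        (f := fun a b i j => pd a (pd b fun y => g t y i j) x) a b i j) i j
    rw [Real.sq_sqrt hu0, ← hP] at key
    rw [hg.2.2 t ht' x hx i j]
    exact key
  have hE : ContinuousOn (fun s => ∫ x, φ x ^ 4 * gradSq g s x) (Icc 0 T) :=
    continuousOn_integral_mul hU hη hηc (hts.trans hφU) hcont
  have := (convex_Icc 0 T).image_sub_le_mul_sub_of_deriv_le hE
    (fun s hs => (hd s (interior_Icc (a := (0 : ℝ)) ▸ hs)).differentiableAt.differentiableWithinAt)
    (C := 10 ^ 7 * (L * P ^ 3) ^ 4 * volume.real V)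
    (fun s hs => by
      rw [interior_Icc] at hs
      rw [(hd s hs).deriv]
      exact hbound s hs) 0 ⟨le_rfl, hT.le⟩ t ht ht.1
  rw [sub_zero] at this
  linarith

end Evolution

/-- almost-monotonicity of the local L² gradient energy for the
Ricci–DeTurck flow with flat background, with `v(σ) = σ/(2+σ)`.
Here `|∂g|^{2+2σ} = (|∂g|²)^{1+σ}`. -/
theorem L2_gradient_almost_monotonicity (n : ℕ) (hn : 1 ≤ n) :
    ∃ ε₀ : ℝ, 0 < ε₀ ∧
      ∀ σ : ℝ, σ ∈ Set.Ioo (0 : ℝ) (1/4) →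
      ∀ r ℓ : ℝ, 0 < r → r < ℓ →
        ∃ c : ℝ, 0 < c ∧
          ∀ (y₀ : Eucl n) (T : ℝ), T ∈ Set.Ioc (0 : ℝ) 1 →
          ∀ g : ℝ → Eucl n → Matrix (Fin n) (Fin n) ℝ,
            IsRicciDeTurckFlow g (Set.Icc 0 T) (ball y₀ (4 * ℓ)) →
            (∀ t ∈ Set.Icc (0 : ℝ) T, ∀ x ∈ ball y₀ (4 * ℓ),
              Real.sqrt (matDistSq (g t x) 1) ≤ ε₀) →
            ∀ t ∈ Set.Icc (0 : ℝ) T,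
              (∫ x in ball y₀ r, gradSq g t x)
                ≤ (∫ x in ball y₀ ℓ, gradSq g 0 x)
                  + t ^ (σ / (2 + σ)) * c *
                    (1 + ∫ x in ball y₀ ℓ, (gradSq g 0 x) ^ (1 + σ)) := by
  let P : ℝ := (n : ℝ) ^ 4
  let M : ℝ := 1000 * (P ^ 3) ^ 2
  have hN : (1 : ℝ) ≤ n := by exact_mod_cast hn
  have hM : 1000 ≤ M := by
    have : (1 : ℝ) ≤ (P ^ 3) ^ 2 := one_le_pow₀ (one_le_pow₀ (one_le_pow₀ hN))
    simp only [M]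
    linarith
  have hM0 : 0 < M := by linarith
  refine ⟨1 / M, by positivity, fun σ hσ r ℓ hr hrℓ => ?_⟩
  obtain ⟨L, hL, hcut⟩ := exists_cutoff n hr hrℓ
  have hℓ : 0 < ℓ := hr.trans hrℓ
  refine ⟨10 ^ 7 * (L * P ^ 3) ^ 4 * volume.real (ball (0 : Eucl n) ℓ) + 1, by positivity,
    fun y₀ T hT g hg hclose t ht => ?_⟩
  obtain ⟨φ, hφ, hφc, hφℓ, hφ0, hφ1, hφr, hφL⟩ := hcut y₀
  have hsub : closedBall y₀ ℓ ⊆ ball y₀ (4 * ℓ) := closedBall_subset_ball (by linarith)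
  have hφU : tsupport φ ⊆ ball y₀ (4 * ℓ) := hφℓ.trans (ball_subset_closedBall.trans hsub)
  have hvol : volume.real (ball y₀ ℓ) = volume.real (ball (0 : Eucl n) ℓ) := by
    rw [measureReal_def, measureReal_def, Measure.addHaar_ball_center]
  have main := hg.localized_energy_le hn hT.1 (P := P) (M := M) rfl rfl (by positivity)
    (by rw [one_div_mul_cancel hM0.ne'])
    ((one_div_le_one_div_of_le two_pos (by linarith))) hL isOpen_ball measurableSet_ball
    measure_ball_lt_top.ne hφ hφc hφU hφℓ hφ0 hφL hclose ht
  rw [hvol] at main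
  have hcont : ∀ s ∈ Icc (0 : ℝ) T, ContinuousOn (gradSq g s) (ball y₀ (4 * ℓ)) := fun s hs =>
    (hg.continuousOn_gradSq isOpen_ball hT.1).comp (f := fun x => (s, x)) (by fun_prop)
      fun x hx => ⟨hs, hx⟩
  have hint : ∀ s ∈ Icc (0 : ℝ) T, IntegrableOn (gradSq g s) (ball y₀ ℓ) := fun s hs =>
    (((hcont s hs).mono hsub).integrableOn_compact (isCompact_closedBall y₀ ℓ)).mono_set
      ball_subset_closedBall
  have hη0 : ∀ x, x ∉ ball y₀ ℓ → φ x ^ 4 = 0 := fun x hx => by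
    rw [image_eq_zero_of_notMem_tsupport fun h => hx (hφℓ h)]
    norm_num
  have hη1 : ∀ x, φ x ^ 4 ≤ 1 := fun x => pow_le_one₀ (hφ0 x) (hφ1 x)
  have hts : tsupport (fun x => φ x ^ 4) ⊆ tsupport φ :=
    closure_mono fun x hx h => hx (by simp [h])
  have hηc : HasCompactSupport fun x => φ x ^ 4 := hφc.mono' (subset_closure.trans hts)
  have hηint : ∀ s ∈ Icc (0 : ℝ) T, Integrable fun x => φ x ^ 4 * gradSq g s x := fun s hs =>
    integrable_mul_of_tsupport_subset (hφ.continuous.pow 4) hηc (hts.trans hφU) (hcont s hs)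
  have hlow : ∫ x in ball y₀ r, gradSq g t x ≤ ∫ x, φ x ^ 4 * gradSq g t x := by
    rw [setIntegral_congr_fun (g := fun x => φ x ^ 4 * gradSq g t x) measurableSet_ball
      fun x hx => by simp [hφr x hx]]
    exact setIntegral_le_integral (hηint t ht)
      (ae_of_all _ fun x => mul_nonneg (pow_nonneg (hφ0 x) 4) (gradSq_nonneg g t x))
  have h0 : (0 : ℝ) ∈ Icc 0 T := ⟨le_rfl, hT.1.le⟩
  have hupp : ∫ x, φ x ^ 4 * gradSq g 0 x ≤ ∫ x in ball y₀ ℓ, gradSq g 0 x := by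
    rw [← setIntegral_eq_integral_of_forall_compl_eq_zero (s := ball y₀ ℓ)
      fun x hx => by rw [hη0 x hx, zero_mul]]
    exact setIntegral_mono_on (hηint 0 h0).integrableOn (hint 0 h0) measurableSet_ball
      fun x _ => mul_le_of_le_one_left (gradSq_nonneg g 0 x) (hη1 x)
  have hI : 0 ≤ ∫ x in ball y₀ ℓ, gradSq g 0 x ^ (1 + σ) :=
    integral_nonneg fun x => Real.rpow_nonneg (gradSq_nonneg g 0 x) _
  have htv : t ≤ t ^ (σ / (2 + σ)) := Real.self_le_rpow_of_le_one ht.1 (ht.2.trans hT.2)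
    ((div_le_one (by linarith [hσ.1])).2 (by linarith))
  have hC : 0 ≤ 10 ^ 7 * (L * P ^ 3) ^ 4 * volume.real (ball (0 : Eucl n) ℓ) := by positivity
  generalize 10 ^ 7 * (L * P ^ 3) ^ 4 * volume.real (ball (0 : Eucl n) ℓ) = C at main hC ⊢
  have h1 : C * t ≤ t ^ (σ / (2 + σ)) * (C + 1) := by
    rw [mul_comm]
    exact mul_le_mul htv (by linarith) hC (ht.1.trans htv)
  have h2 : t ^ (σ / (2 + σ)) * (C + 1) ≤ t ^ (σ / (2 + σ)) * (C + 1) *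
      (1 + ∫ x in ball y₀ ℓ, gradSq g 0 x ^ (1 + σ)) :=
    le_mul_of_one_le_right (mul_nonneg (ht.1.trans htv) (by linarith)) (by linarith)
  linarith
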